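/- Let 0 < α < 1 and let λ ∈ ℂ be nonzero with |arg(λ)| < απ/2. Then |E_α(λ t^α)| → ∞ as t → ∞. -/

import Mathlib

open Filter Real

/-- The two-parameter Mittag-Leffler function `E_{α,β}(z) = ∑_{k=0}^∞ z^k / Γ(αk + β)`. -/
noncomputable def mittagLeffler (α β : ℝ) (z : ℂ) : ℂ :=
  ∑' k : ℕ, z ^ k / Complex.Gamma (α * k + β)

open MeasureTheory

theorem rpow_mul_exp_neg_le_Gamma {T x : ℝ} (hT : 0 < T) (hx : 0 ≤ x) :
    T ^ x * exp (-T) ≤ Real.Gamma (x + 1) := by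
  have hInt := Real.GammaIntegral_convergent (s := x + 1) (by linarith)
  rw [Real.Gamma_eq_integral (by linarith), ← integral_exp_neg_Ioi T, ← integral_const_mul]
  rw [add_sub_cancel_right] at *
  have hsub : Set.Ioi T ⊆ Set.Ioi 0 := Set.Ioi_subset_Ioi hT.le
  refine le_trans (setIntegral_mono_on ((exp_neg_integrableOn_Ioi T one_pos).congr_fun
    (fun y _ => by simp) measurableSet_Ioi |>.const_mul _) (hInt.mono_set hsub)
    measurableSet_Ioi ?_) (setIntegral_mono_set hInt ?_ hsub.eventuallyLE)
  · intro y hy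
    rw [mul_comm]
    have : T ^ x ≤ y ^ x := rpow_le_rpow hT.le (le_of_lt hy) hx
    gcongr
  · filter_upwards [ae_restrict_mem measurableSet_Ioi] with y hy
    have : (0 : ℝ) < y := hy
    simp only [Pi.zero_apply]
    positivity

theorem summable_pow_div_Gamma {α : ℝ} (hα : 0 < α) {r : ℝ} (hr : 0 ≤ r) :
    Summable fun k : ℕ => r ^ k / Real.Gamma (α * k + 1) := by
  set T : ℝ := (r + 1) ^ α⁻¹
  have hT : 0 < T := by positivity
  have hTα : T ^ α = r + 1 := by
    rw [← rpow_mul (by positivity), inv_mul_cancel₀ hα.ne', rpow_one]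
  refine Summable.of_nonneg_of_le (fun k => ?_) (fun k => ?_)
    ((summable_geometric_of_lt_one (r := r / (r + 1)) (by positivity)
      (by rw [div_lt_one] <;> linarith)).mul_left (exp T))
  · have := Real.Gamma_pos_of_pos (s := α * k + 1) (by positivity)
    positivity
  · have h := rpow_mul_exp_neg_le_Gamma hT (x := α * k) (by positivity)
    rw [rpow_mul hT.le, hTα, rpow_natCast] at h
    calc r ^ k / Real.Gamma (α * k + 1) ≤ r ^ k / ((r + 1) ^ k * exp (-T)) := by gcongr
      _ = exp T * (r / (r + 1)) ^ k := by
        rw [exp_neg, div_pow]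
        field_simp

theorem norm_pow_div_Gamma {α : ℝ} (hα : 0 < α) (z : ℂ) (k : ℕ) :
    ‖z ^ k / Complex.Gamma (α * k + (1 : ℝ))‖ = ‖z‖ ^ k / Real.Gamma (α * k + 1) := by
  have : ((α : ℂ) * k + (1 : ℝ)) = ((α * k + 1 : ℝ) : ℂ) := by push_cast; rfl
  rw [this, Complex.Gamma_ofReal, norm_div, norm_pow, Complex.norm_real, Real.norm_of_nonneg]
  exact (Real.Gamma_pos_of_pos (by positivity)).le

theorem continuous_mittagLeffler {α : ℝ} (hα : 0 < α) : Continuous (mittagLeffler α 1) := by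
  rw [continuous_iff_continuousAt]
  intro z
  have hc : ContinuousOn (mittagLeffler α 1) (Metric.ball 0 (‖z‖ + 1)) := by
    refine continuousOn_tsum (fun k => by fun_prop)
      (summable_pow_div_Gamma hα (r := ‖z‖ + 1) (by positivity)) fun k w hw => ?_
    rw [norm_pow_div_Gamma hα]
    have := Real.Gamma_pos_of_pos (s := α * k + 1) (by positivity)
    have : ‖w‖ ≤ ‖z‖ + 1 := (mem_ball_zero_iff.1 hw).le
    gcongr
  exact hc.continuousAt (Metric.isOpen_ball.mem_nhds (by simp))


theorem integrableOn_rpow_mul_exp_neg {x r : ℝ} (hx : -1 < x) (hr : 0 < r) :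
    IntegrableOn (fun t : ℝ => t ^ x * exp (-(r * t))) (Set.Ioi 0) := by
  have h := Real.integral_rpow_mul_exp_neg_mul_Ioi (a := x + 1) (by linarith) hr
  rw [add_sub_cancel_right] at h
  refine Integrable.of_integral_ne_zero (h ▸ ?_)
  have := Real.Gamma_pos_of_pos (s := x + 1) (by linarith)
  positivity

theorem integral_rpow_mul_cexp_neg {x : ℝ} (hx : -1 < x) {s : ℂ} (hs : 0 < s.re) :
    ∫ t in Set.Ioi (0 : ℝ), ((t ^ x : ℝ) : ℂ) * Complex.exp (-(s * t)) =
      Real.Gamma (x + 1) * s ^ (-((x + 1 : ℝ) : ℂ)) := by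
  set μ := (volume.restrict (Set.Ioi (0 : ℝ))).withDensity fun t => ENNReal.ofReal (t ^ x)
  have hmgf (z : ℂ) : ProbabilityTheory.complexMGF id μ (-z) =
      ∫ t in Set.Ioi (0 : ℝ), ((t ^ x : ℝ) : ℂ) * Complex.exp (-(z * t)) := by
    simp only [ProbabilityTheory.complexMGF, μ]
    rw [integral_withDensity_eq_integral_toReal_smul (by fun_prop) (by simp)]
    refine setIntegral_congr_fun measurableSet_Ioi fun t ht => ?_
    have : (0 : ℝ) < t := ht
    simp [ENNReal.toReal_ofReal (show 0 ≤ t ^ x by positivity)]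
  have hexp : Set.Iio 0 ⊆ ProbabilityTheory.integrableExpSet id μ := by
    intro r hr
    simp only [ProbabilityTheory.integrableExpSet, Set.mem_ofPred_eq, μ]
    rw [integrable_withDensity_iff_integrable_smul' (by fun_prop) (by simp)]
    refine (integrableOn_rpow_mul_exp_neg hx (neg_pos.2 hr)).congr_fun (fun t ht => ?_)
      measurableSet_Ioi
    have : (0 : ℝ) < t := ht
    simp [ENNReal.toReal_ofReal (show 0 ≤ t ^ x by positivity)]
  have hU : IsOpen {z : ℂ | 0 < z.re} := isOpen_lt continuous_const Complex.continuous_re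
  have hA : AnalyticOnNhd ℂ (fun z => ProbabilityTheory.complexMGF id μ (-z)) {z | 0 < z.re} := by
    intro z hz
    refine (ProbabilityTheory.analyticAt_complexMGF (z := -z) ?_).fun_comp analyticAt_id.neg
    refine interior_maximal hexp isOpen_Iio ?_
    simpa using! hz
  have hB : AnalyticOnNhd ℂ (fun z : ℂ => Real.Gamma (x + 1) * z ^ (-((x + 1 : ℝ) : ℂ)))
      {z | 0 < z.re} := by
    refine DifferentiableOn.analyticOnNhd (fun z hz => DifferentiableAt.differentiableWithinAt ?_) hU
    exact (differentiableAt_id.cpow_const (Or.inl hz)).const_mul _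
  have hpre : IsPreconnected {z : ℂ | 0 < z.re} :=
    (convex_halfSpace_re_gt 0).isPreconnected
  have key := hA.eqOn_of_preconnected_of_frequently_eq hB hpre (z₀ := 1) (by simp) ?_
  · rw [← hmgf]
    exact key hs
  · have hreal : ∃ᶠ r : ℝ in nhdsWithin 1 {1}ᶜ, 0 < r :=
      (eventually_nhdsWithin_of_eventually_nhds (lt_mem_nhds one_pos)).frequently
    have htend : Tendsto (fun r : ℝ => (r : ℂ)) (nhdsWithin 1 {1}ᶜ) (nhdsWithin 1 {1}ᶜ) := by
      refine tendsto_nhdsWithin_iff.2 ⟨?_, ?_⟩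
      · exact (Complex.continuous_ofReal.tendsto' 1 1 (by simp)).mono_left nhdsWithin_le_nhds
      · filter_upwards [self_mem_nhdsWithin] with r hr
        simpa using hr
    refine htend.frequently (hreal.mono fun r hr => ?_)
    rw [hmgf]
    have h := Real.integral_rpow_mul_exp_neg_mul_Ioi (a := x + 1) (by linarith) hr
    rw [add_sub_cancel_right, one_div, inv_rpow hr.le, ← rpow_neg hr.le, mul_comm] at h
    rw [← Complex.ofReal_neg, ← Complex.ofReal_cpow hr.le, ← Complex.ofReal_mul, ← h]
    refine Eq.trans ?_ (integral_ofReal (𝕜 := ℂ))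
    simp

theorem laplace_mittagLeffler {α : ℝ} (hα : 0 < α) {lam s : ℂ} (hs : 0 < s.re)
    (hlam : ‖lam‖ < s.re ^ α) :
    IntegrableOn (fun t : ℝ => mittagLeffler α 1 (lam * ((t ^ α : ℝ) : ℂ)) *
      Complex.exp (-(s * t))) (Set.Ioi 0) ∧
    ∫ t in Set.Ioi (0 : ℝ), mittagLeffler α 1 (lam * ((t ^ α : ℝ) : ℂ)) *
      Complex.exp (-(s * t)) = s⁻¹ * (1 - lam * s ^ (-α : ℂ))⁻¹ := by
  have hs0 : s ≠ 0 := by rintro rfl; simp at hs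
  set F : ℕ → ℝ → ℂ := fun k t => (lam * ((t ^ α : ℝ) : ℂ)) ^ k /
    Complex.Gamma (α * k + (1 : ℝ)) * Complex.exp (-(s * t)) with hF
  have hΓ (k : ℕ) : 0 < Real.Gamma (α * k + 1) := Real.Gamma_pos_of_pos (by positivity)
  have hΓc (k : ℕ) : Complex.Gamma (α * k + (1 : ℝ)) = Real.Gamma (α * k + 1) := by
    rw [← Complex.Gamma_ofReal]; push_cast; rfl
  have hFt (k : ℕ) (t : ℝ) (ht : t ∈ Set.Ioi (0 : ℝ)) : F k t = lam ^ k / Real.Gamma (α * k + 1) *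
      (((t ^ (α * k) : ℝ) : ℂ) * Complex.exp (-(s * t))) := by
    simp only [hF]
    rw [hΓc, mul_pow, rpow_mul (le_of_lt ht), rpow_natCast]
    push_cast
    ring
  have hnorm (k : ℕ) (t : ℝ) (ht : t ∈ Set.Ioi (0 : ℝ)) : ‖F k t‖ =
      ‖lam‖ ^ k / Real.Gamma (α * k + 1) * (t ^ (α * k) * exp (-(s.re * t))) := by
    have ht' : (0 : ℝ) < t := ht
    rw [hFt k t ht, norm_mul, norm_mul, norm_div, norm_pow, Complex.norm_real, Complex.norm_real,
      Complex.norm_exp, Real.norm_of_nonneg (hΓ k).le, Real.norm_of_nonneg (by positivity)]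
    simp
  have hk (k : ℕ) : -1 < α * k := by linarith [show 0 ≤ α * k by positivity]
  have hFint (k : ℕ) : IntegrableOn (F k) (Set.Ioi 0) := by
    refine Integrable.mono' ((integrableOn_rpow_mul_exp_neg (hk k) hs).const_mul
      (‖lam‖ ^ k / Real.Gamma (α * k + 1))) (by fun_prop) ?_
    filter_upwards [ae_restrict_mem measurableSet_Ioi] with t ht using (hnorm k t ht).le
  have hFnorm (k : ℕ) : ∫ t in Set.Ioi (0 : ℝ), ‖F k t‖ = s.re⁻¹ * (‖lam‖ / s.re ^ α) ^ k := by
    rw [setIntegral_congr_fun measurableSet_Ioi (hnorm k), integral_const_mul]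
    have h := Real.integral_rpow_mul_exp_neg_mul_Ioi (a := α * k + 1) (by positivity) hs
    rw [add_sub_cancel_right] at h
    have := (hΓ k).ne'
    rw [h, one_div, inv_rpow hs.le, rpow_add hs, rpow_mul hs.le, rpow_natCast, rpow_one, div_pow]
    field_simp
  have hFsum : Summable fun k => ∫ t in Set.Ioi (0 : ℝ), ‖F k t‖ := by
    simp_rw [hFnorm]
    exact (summable_geometric_of_lt_one (by positivity)
      (by rwa [div_lt_one (by positivity)])).mul_left _
  have htsum (t : ℝ) : ∑' k, F k t =
      mittagLeffler α 1 (lam * ((t ^ α : ℝ) : ℂ)) * Complex.exp (-(s * t)) := by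
    simp only [hF, tsum_mul_right, mittagLeffler]
  constructor
  · have hInt : IntegrableOn (fun t => ∑' k, ‖F k t‖) (Set.Ioi 0) := by
      refine Integrable.of_integral_ne_zero ?_
      have h := hasSum_integral_of_summable_integral_norm (F := fun k t => ‖F k t‖)
        (fun k => (hFint k).norm) (by simpa using hFsum)
      rw [← h.tsum_eq]
      refine (h.summable.tsum_pos (fun k => ?_) 0 ?_).ne'
      · positivity
      · simp only [hFnorm]
        simpa using hs
    refine hInt.mono' ?_ (ae_of_all _ fun t => ?_)
    · have := continuous_mittagLeffler hα
      exact ((this.measurable.comp (by fun_prop)).mul (by fun_prop)).aestronglyMeasurable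
    · rw [← htsum]
      refine norm_tsum_le_tsum_norm ?_
      simp only [hF, norm_mul _ (Complex.exp _), norm_pow_div_Gamma hα]
      exact (summable_pow_div_Gamma hα (norm_nonneg _)).mul_right _
  · simp_rw [← htsum]
    rw [← (hasSum_integral_of_summable_integral_norm hFint hFsum).tsum_eq]
    have hval (k : ℕ) : ∫ t in Set.Ioi (0 : ℝ), F k t = s⁻¹ * (lam * s ^ (-α : ℂ)) ^ k := by
      rw [setIntegral_congr_fun measurableSet_Ioi (hFt k), integral_const_mul,
        integral_rpow_mul_cexp_neg (hk k) hs]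
      have : (Real.Gamma (α * k + 1) : ℂ) ≠ 0 := by exact_mod_cast (hΓ k).ne'
      have he : (-((α * k + 1 : ℝ) : ℂ)) = k * (-α : ℂ) + (-1) := by push_cast; ring
      rw [he, Complex.cpow_add _ _ hs0, Complex.cpow_nat_mul, Complex.cpow_neg_one, mul_pow]
      field_simp
    simp_rw [hval]
    rw [tsum_mul_left, tsum_geometric_of_norm_lt_one]
    have hle : s.re ^ α ≤ ‖s‖ ^ α := by
      have := Complex.re_le_norm s
      gcongr
    rw [norm_mul, ← Complex.ofReal_neg, Complex.norm_cpow_real, rpow_neg (norm_nonneg _),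
      ← div_eq_mul_inv, div_lt_one (by positivity)]
    linarith

theorem integrable_vertical {f : ℂ → ℂ} {a b c C r : ℝ} (hac : a ≤ c) (hcb : c ≤ b) (hr : 1 < r)
    (hf : ContinuousOn f {z | a ≤ z.re ∧ z.re ≤ b})
    (hbound : ∀ z : ℂ, a ≤ z.re → z.re ≤ b → ‖f z‖ ≤ C * (1 + |z.im|) ^ (-r)) :
    Integrable fun y : ℝ => f (c + y * Complex.I) := by
  have hI : Integrable fun y : ℝ => C * (1 + ‖y‖) ^ (-r) :=
    (integrable_one_add_norm (by simpa using hr)).const_mul C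
  refine hI.mono' (Continuous.aestronglyMeasurable ?_) (ae_of_all _ fun y => ?_)
  · exact hf.comp_continuous (by fun_prop) fun y => by simp [hac, hcb]
  · simpa using hbound (c + y * Complex.I) (by simpa using hac) (by simpa using hcb)

theorem integral_vertical_eq_of_differentiableOn {f : ℂ → ℂ} {a b C r : ℝ} (hab : a ≤ b)
    (hr : 1 < r) (hf : DifferentiableOn ℂ f {z | a ≤ z.re ∧ z.re ≤ b})
    (hbound : ∀ z : ℂ, a ≤ z.re → z.re ≤ b → ‖f z‖ ≤ C * (1 + |z.im|) ^ (-r)) :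
    ∫ y : ℝ, f (a + y * Complex.I) = ∫ y : ℝ, f (b + y * Complex.I) := by
  have hlim (c : ℝ) (hac : a ≤ c) (hcb : c ≤ b) :
      Tendsto (fun T : ℝ => ∫ y in (-T)..T, f (c + y * Complex.I)) atTop
        (nhds (∫ y : ℝ, f (c + y * Complex.I))) :=
    intervalIntegral_tendsto_integral
      (integrable_vertical hac hcb hr hf.continuousOn hbound) tendsto_neg_atTop_atBot tendsto_id
  have hdecay : Tendsto (fun T : ℝ => C * (1 + |T|) ^ (-r) * |b - a|) atTop (nhds 0) := by
    have h1 : Tendsto (fun T : ℝ => 1 + |T|) atTop atTop :=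
      tendsto_atTop_add_const_left _ _ tendsto_abs_atTop_atTop
    simpa using (((tendsto_rpow_neg_atTop (by linarith : 0 < r)).comp h1).const_mul C).mul_const
      |b - a|
  have hhor (σ : ℝ) (hσ : |σ| = 1) : Tendsto (fun T : ℝ =>
      ∫ x in a..b, f (x + ((σ * T : ℝ) : ℂ) * Complex.I)) atTop (nhds 0) := by
    refine squeeze_zero_norm (fun T => ?_) hdecay
    refine intervalIntegral.norm_integral_le_of_norm_le_const fun x hx => ?_
    rw [Set.uIoc_of_le hab] at hx
    simpa [abs_mul, hσ] using hbound (x + ((σ * T : ℝ) : ℂ) * Complex.I)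
      (by simpa using hx.1.le) (by simpa using hx.2)
  have hrect (T : ℝ) := Complex.integral_boundary_rect_eq_zero_of_differentiableOn f
    (⟨a, -T⟩) (⟨b, T⟩) (hf.mono fun z hz => by
      simpa [Set.uIcc_of_le hab] using (Complex.mem_reProdIm.1 hz).1)
  have h0 := (((hhor (-1) (by simp)).sub (hhor 1 (by simp))).add
    ((hlim b hab le_rfl).const_smul Complex.I)).sub ((hlim a le_rfl hab).const_smul Complex.I)
  have h1 := tendsto_nhds_unique (h0.congr fun T => by simpa using hrect T)
    (tendsto_const_nhds (x := (0 : ℂ)))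
  have h2 : Complex.I * ((∫ y : ℝ, f (b + y * Complex.I)) - ∫ y : ℝ, f (a + y * Complex.I)) = 0 := by
    rw [← h1]; simp; ring
  exact (sub_eq_zero.1 ((mul_eq_zero.1 h2).resolve_left Complex.I_ne_zero)).symm

theorem mittagLeffler_pole {α : ℝ} (hα₀ : 0 < α) (hα₁ : α < 1) {lam : ℂ} (hlam : lam ≠ 0)
    (harg : |Complex.arg lam| < α * π / 2) :
    ∃ s₀ : ℂ, 0 < s₀.re ∧ s₀ ^ (α : ℂ) = lam ∧
      ∀ s : ℂ, 0 < s.re → s ^ (α : ℂ) = lam → s = s₀ := by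
  have hαc : (α : ℂ) ≠ 0 := by exact_mod_cast hα₀.ne'
  obtain ⟨h1, h2⟩ := abs_lt.1 harg
  have him : (Complex.log lam * (α⁻¹ : ℝ)).im = Complex.arg lam / α := by
    rw [Complex.im_mul_ofReal, Complex.log_im]; rfl
  have hlt : Complex.arg lam / α < π / 2 := by rw [div_lt_iff₀ hα₀]; linarith
  have hgt : -(π / 2) < Complex.arg lam / α := by rw [lt_div_iff₀ hα₀]; linarith
  have hpi := Real.pi_pos
  refine ⟨lam ^ ((α⁻¹ : ℝ) : ℂ), ?_, ?_, ?_⟩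
  · rw [Complex.cpow_def_of_ne_zero hlam, Complex.exp_re, him]
    exact mul_pos (exp_pos _) (cos_pos_of_mem_Ioo ⟨hgt, hlt⟩)
  · rw [← Complex.cpow_mul _ (by rw [him]; linarith) (by rw [him]; linarith)]
    push_cast
    rw [inv_mul_cancel₀ hαc, Complex.cpow_one]
  · rintro s hs rfl
    have hargs := abs_lt.1 (Complex.abs_arg_lt_pi_div_two_iff.2 (Or.inl hs))
    have him' : (Complex.log s * α).im = Complex.arg s * α := by
      rw [Complex.im_mul_ofReal, Complex.log_im]
    rw [← Complex.cpow_mul]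
    · push_cast
      rw [mul_inv_cancel₀ hαc, Complex.cpow_one]
    · rw [him']; nlinarith
    · rw [him']; nlinarith

/-- Removing the pole at `s₀` from the Laplace transform of `t ↦ E_α(λ t^α) - 1`. -/
theorem exists_regularized_laplace {α : ℝ} (hα₀ : 0 < α) {lam s₀ : ℂ}
    (hlam : lam ≠ 0) (hs₀ : 0 < s₀.re) (hpow : s₀ ^ (α : ℂ) = lam)
    (huniq : ∀ s : ℂ, 0 < s.re → s ^ (α : ℂ) = lam → s = s₀) :
    ∃ g : ℂ → ℂ, DifferentiableOn ℂ g {s | 0 < s.re} ∧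
      ∀ s : ℂ, 0 < s.re → s ≠ s₀ →
        g s = s⁻¹ * (lam / (s ^ (α : ℂ) - lam) - s₀ / (α * (s - s₀))) := by
  have hαc : (α : ℂ) ≠ 0 := by exact_mod_cast hα₀.ne'
  have hs₀' : s₀ ≠ 0 := by rintro rfl; simp at hs₀
  have hnhds : {s : ℂ | 0 < s.re} ∈ nhds s₀ :=
    (isOpen_lt continuous_const Complex.continuous_re).mem_nhds hs₀
  have hd : DifferentiableOn ℂ (fun s : ℂ => s ^ (α : ℂ)) {s | 0 < s.re} := fun s hs =>
    (differentiableAt_id.cpow_const (Or.inl hs)).differentiableWithinAt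
  set q : ℂ → ℂ := dslope (fun s : ℂ => s ^ (α : ℂ)) s₀ with hq
  have hqd : DifferentiableOn ℂ q {s | 0 < s.re} := (Complex.differentiableOn_dslope hnhds).2 hd
  have hqs (s : ℂ) (hs : s ≠ s₀) : q s = (s - s₀)⁻¹ * (s ^ (α : ℂ) - lam) := by
    rw [hq, dslope_of_ne _ hs, slope_def_module, hpow, smul_eq_mul]
  have hq₀ : q s₀ = α * lam / s₀ := by
    have h := (hasDerivAt_id' s₀).cpow_const (c := (α : ℂ)) (Or.inl hs₀)
    rw [hq, dslope_same, h.deriv, Complex.cpow_sub _ _ hs₀', hpow, Complex.cpow_one]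
    ring
  have hq_ne (s : ℂ) (hs : 0 < s.re) : q s ≠ 0 := by
    by_cases h : s = s₀
    · rw [h, hq₀]
      exact div_ne_zero (mul_ne_zero hαc hlam) hs₀'
    · rw [hqs s h]
      exact mul_ne_zero (inv_ne_zero (sub_ne_zero.2 h)) (sub_ne_zero.2 fun hp => h (huniq s hs hp))
  set p : ℂ → ℂ := fun s => lam - s₀ * q s / α with hp
  have hpd : DifferentiableOn ℂ (dslope p s₀) {s | 0 < s.re} :=
    (Complex.differentiableOn_dslope hnhds).2 (((hqd.const_mul s₀).div_const _).const_sub _)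
  have hp₀ : p s₀ = 0 := by
    simp only [hp, hq₀]
    field_simp
    ring
  refine ⟨fun s => dslope p s₀ s / (s * q s), hpd.div (differentiableOn_id.mul hqd) fun s hs => ?_,
    fun s hs hne => ?_⟩
  · refine mul_ne_zero ?_ (hq_ne s hs)
    rintro rfl
    simp at hs
  · have hs' : s ≠ 0 := by rintro rfl; simp at hs
    have h1 : s - s₀ ≠ 0 := sub_ne_zero.2 hne
    have h2 : s ^ (α : ℂ) - lam ≠ 0 := sub_ne_zero.2 fun h => hne (huniq s hs h)
    simp only [dslope_of_ne _ hne, slope_def_module, hp₀, smul_eq_mul, hqs s hne]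
    simp only [hp, hqs s hne]
    field_simp
    ring

theorem exists_vertical_strip_bound {α : ℝ} (hα₀ : 0 < α) (hα₁ : α < 1) {lam s₀ : ℂ}
    {g : ℂ → ℂ} (hg : DifferentiableOn ℂ g {s | 0 < s.re})
    (hgs : ∀ s : ℂ, 0 < s.re → s ≠ s₀ →
      g s = s⁻¹ * (lam / (s ^ (α : ℂ) - lam) - s₀ / (α * (s - s₀)))) {a : ℝ} (ha : 0 < a) (b : ℝ) :
    ∃ C : ℝ, ∀ s : ℂ, a ≤ s.re → s.re ≤ b → ‖g s‖ ≤ C * (1 + |s.im|) ^ (-(1 + α)) := by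
  set M : ℝ := 1 + 2 * ‖s₀‖ + (2 * ‖lam‖) ^ α⁻¹
  have hA : 0 ≤ (2 * ‖lam‖) ^ α⁻¹ := by positivity
  have hM1 : 1 ≤ M := by linarith [norm_nonneg s₀]
  have hcomp : IsCompact (Set.Icc a b ×ℂ Set.Icc (-M) M) := isCompact_Icc.reProdIm isCompact_Icc
  obtain ⟨K, hK⟩ := hcomp.exists_bound_of_continuousOn (f := g) (hg.continuousOn.mono fun s hs =>
    ha.trans_le (Complex.mem_reProdIm.1 hs).1.1)
  set D : ℝ := 2 * ‖lam‖ + 2 * ‖s₀‖ / α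
  have hD : 0 ≤ D := by positivity
  refine ⟨max (K * (1 + M) ^ (1 + α)) (D * 2 ^ (1 + α)), fun s hsa hsb => ?_⟩
  have hspos : 0 < s.re := ha.trans_le hsa
  have h1 : 0 < 1 + |s.im| := by positivity
  rcases le_total |s.im| M with hle | hge
  · have hgK := hK s (Complex.mem_reProdIm.2 ⟨⟨hsa, hsb⟩, abs_le.1 hle⟩)
    have hK0 : 0 ≤ K := (norm_nonneg _).trans hgK
    calc ‖g s‖ ≤ K := hgK
      _ = K * (1 + |s.im|) ^ (1 + α) * (1 + |s.im|) ^ (-(1 + α)) := by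
        rw [mul_assoc, ← rpow_add h1, add_neg_cancel, rpow_zero, mul_one]
      _ ≤ K * (1 + M) ^ (1 + α) * (1 + |s.im|) ^ (-(1 + α)) := by gcongr
      _ ≤ _ := by gcongr; exact le_max_left _ _
  · have hns : |s.im| ≤ ‖s‖ := Complex.abs_im_le_norm s
    have hn1 : 1 ≤ ‖s‖ := by linarith
    have hn0 : 0 < ‖s‖ := by linarith
    have hne : s ≠ s₀ := by rintro rfl; linarith
    have hlam_le : 2 * ‖lam‖ ≤ ‖s‖ ^ α := by
      have h := rpow_le_rpow hA (show (2 * ‖lam‖) ^ α⁻¹ ≤ ‖s‖ by linarith [norm_nonneg s₀]) hα₀.le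
      rwa [← rpow_mul (by positivity), inv_mul_cancel₀ hα₀.ne', rpow_one] at h
    have hp0 : 0 < ‖s‖ ^ α := by positivity
    have hb1 : ‖s‖ ^ α / 2 ≤ ‖s ^ (α : ℂ) - lam‖ := by
      have := norm_sub_norm_le (s ^ (α : ℂ)) lam
      rw [Complex.norm_cpow_real] at this
      linarith
    have hb2 : ‖s‖ ^ α / 2 ≤ ‖s - s₀‖ := by
      have := norm_sub_norm_le s s₀
      have h3 : ‖s‖ ^ α ≤ ‖s‖ ^ (1 : ℝ) := rpow_le_rpow_of_exponent_le hn1 hα₁.le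
      rw [rpow_one] at h3
      linarith
    have hsnorm : ‖s‖ ^ (-(1 + α)) ≤ 2 ^ (1 + α) * (1 + |s.im|) ^ (-(1 + α)) := by
      have h4 : (1 + |s.im|) / 2 ≤ ‖s‖ := by linarith
      have h5 := rpow_le_rpow_of_nonpos (z := -(1 + α)) (by positivity) h4 (by linarith)
      rwa [div_rpow h1.le (by norm_num), rpow_neg (by norm_num : (0 : ℝ) ≤ 2), div_inv_eq_mul,
        mul_comm] at h5
    calc ‖g s‖ = ‖s‖⁻¹ * ‖lam / (s ^ (α : ℂ) - lam) - s₀ / (α * (s - s₀))‖ := by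
          rw [hgs s hspos hne, norm_mul, norm_inv]
      _ ≤ ‖s‖⁻¹ * (‖lam‖ / ‖s ^ (α : ℂ) - lam‖ + ‖s₀‖ / (α * ‖s - s₀‖)) := by
          gcongr
          refine (norm_sub_le _ _).trans_eq ?_
          rw [norm_div, norm_div, norm_mul, Complex.norm_real, Real.norm_of_nonneg hα₀.le]
      _ ≤ ‖s‖⁻¹ * (‖lam‖ / (‖s‖ ^ α / 2) + ‖s₀‖ / (α * (‖s‖ ^ α / 2))) := by gcongr
      _ = D * ‖s‖ ^ (-(1 + α)) := by
          rw [rpow_neg hn0.le, rpow_add hn0, rpow_one]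
          simp only [D]
          field_simp
      _ ≤ D * (2 ^ (1 + α) * (1 + |s.im|) ^ (-(1 + α))) := by gcongr
      _ ≤ _ := by
          rw [← mul_assoc]
          gcongr
          exact le_max_right _ _

/-- Fourier inversion on the vertical line `re s = c`. -/
theorem eq_integral_of_laplace_eq {u g : ℝ → ℂ} {c : ℝ}
    (hu : IntegrableOn (fun t : ℝ => u t * Complex.exp (-(c * t))) (Set.Ioi 0))
    (hlap : ∀ y : ℝ, ∫ t in Set.Ioi (0 : ℝ), u t * Complex.exp (-((c + y * Complex.I) * t)) = g y)
    (hg : Integrable g) {t : ℝ} (ht : 0 < t) (hcont : ContinuousAt u t) :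
    u t = ((2 * π)⁻¹ : ℝ) • ∫ y : ℝ, Complex.exp ((c + y * Complex.I) * t) * g y := by
  set f : ℝ → ℂ := (Set.Ioi 0).indicator fun t : ℝ => u t * Complex.exp (-(c * t)) with hf
  have hfi : Integrable f := (integrable_indicator_iff measurableSet_Ioi).2 hu
  have hFf (y : ℝ) : FourierTransform.fourier f y = g (2 * π * y) := by
    rw [Real.fourier_real_eq_integral_exp_smul, ← hlap, ← integral_indicator measurableSet_Ioi]
    congr 1 with x
    by_cases hx : x ∈ Set.Ioi (0 : ℝ)
    · simp only [hf, Set.indicator_of_mem hx, smul_eq_mul]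
      rw [mul_left_comm, ← Complex.exp_add]
      congr 2
      push_cast
      ring
    · simp [hf, Set.indicator_of_notMem hx]
  have h2pi : 2 * π ≠ 0 := by positivity
  have hFi : Integrable (FourierTransform.fourier f) := by
    rw [show FourierTransform.fourier f = fun y => g (2 * π * y) from funext hFf]
    exact hg.comp_mul_left' h2pi
  have hfc : ContinuousAt f t := by
    have : f =ᶠ[nhds t] fun t : ℝ => u t * Complex.exp (-(c * t)) := by
      filter_upwards [Ioi_mem_nhds ht] with x hx
      simp only [hf, Set.indicator_of_mem (show x ∈ Set.Ioi 0 from hx)]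
    exact ContinuousAt.congr (hcont.mul (by fun_prop)) this.symm
  have hinv := hfi.fourierInv_fourier_eq hFi hfc
  rw [Real.fourierInv_eq'] at hinv
  have hft : f t = u t * Complex.exp (-(c * t)) := by
    simp only [hf, Set.indicator_of_mem (show t ∈ Set.Ioi 0 from ht)]
  have hsub := Measure.integral_comp_mul_left
    (fun y : ℝ => Complex.exp ((c + y * Complex.I) * t) * g y) (2 * π)
  rw [abs_of_nonneg (by positivity)] at hsub
  rw [← hsub]
  calc u t = Complex.exp (c * t) * f t := by
        rw [hft, mul_left_comm, ← Complex.exp_add, add_neg_cancel, Complex.exp_zero, mul_one]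
    _ = _ := by
        rw [← hinv, ← integral_const_mul]
        congr 1 with y
        rw [hFf, smul_eq_mul, ← mul_assoc, ← Complex.exp_add]
        congr 2
        simp only [RCLike.inner_apply, conj_trivial]
        push_cast
        ring

theorem exists_mittagLeffler_asymptotic_bound {α : ℝ} (hα₀ : 0 < α) (hα₁ : α < 1) {lam s₀ : ℂ}
    (hlam : lam ≠ 0) (hs₀ : 0 < s₀.re) (hpow : s₀ ^ (α : ℂ) = lam)
    (huniq : ∀ s : ℂ, 0 < s.re → s ^ (α : ℂ) = lam → s = s₀) {a : ℝ} (ha : 0 < a) :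
    ∃ D : ℝ, ∀ t : ℝ, 0 < t → ‖mittagLeffler α 1 (lam * ((t ^ α : ℝ) : ℂ)) - 1 -
      (α : ℂ)⁻¹ * (Complex.exp (s₀ * t) - 1)‖ ≤ D * exp (a * t) := by
  have hαc : (α : ℂ) ≠ 0 := by exact_mod_cast hα₀.ne'
  obtain ⟨g, hg, hgs⟩ := exists_regularized_laplace hα₀ hlam hs₀ hpow huniq
  set c : ℝ := a + s₀.re + (‖lam‖ + 1) ^ α⁻¹ with hc
  have hB : 0 < (‖lam‖ + 1) ^ α⁻¹ := by positivity
  have hac : a ≤ c := by linarith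
  have hc0 : 0 < c := by linarith
  have hcs : s₀.re < c := by linarith
  have hclam : ‖lam‖ < c ^ α := by
    have h := rpow_le_rpow hB.le (show (‖lam‖ + 1) ^ α⁻¹ ≤ c by linarith) hα₀.le
    rw [← rpow_mul (by positivity), inv_mul_cancel₀ hα₀.ne', rpow_one] at h
    linarith
  obtain ⟨C, hC⟩ := exists_vertical_strip_bound hα₀ hα₁ hg hgs ha c
  have hr : 1 < 1 + α := by linarith
  have hgstrip : DifferentiableOn ℂ g {s | a ≤ s.re ∧ s.re ≤ c} :=
    hg.mono fun s hs => ha.trans_le hs.1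
  set u : ℝ → ℂ := fun t => mittagLeffler α 1 (lam * ((t ^ α : ℝ) : ℂ)) - 1 -
    (α : ℂ)⁻¹ * (Complex.exp (s₀ * t) - 1) with hu
  have hlap (s : ℂ) (hs : s.re = c) :
      IntegrableOn (fun t : ℝ => u t * Complex.exp (-(s * t))) (Set.Ioi 0) ∧
      ∫ t in Set.Ioi (0 : ℝ), u t * Complex.exp (-(s * t)) = g s := by
    have hspos : 0 < s.re := hs ▸ hc0
    have hs0 : s ≠ 0 := by rintro rfl; simp at hspos
    have hne : s ≠ s₀ := by rintro rfl; exact hcs.ne hs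
    have hexp (z : ℂ) (hz : z.re < s.re) :
        IntegrableOn (fun t : ℝ => Complex.exp ((z - s) * t)) (Set.Ioi 0) ∧
        ∫ t in Set.Ioi (0 : ℝ), Complex.exp ((z - s) * t) = (s - z)⁻¹ := by
      have hre : (z - s).re < 0 := by simpa using hz
      refine ⟨integrableOn_exp_mul_complex_Ioi hre 0, ?_⟩
      rw [integral_exp_mul_complex_Ioi hre, Complex.ofReal_zero, mul_zero, Complex.exp_zero,
        neg_div, ← div_neg, neg_sub, one_div]
    obtain ⟨hi₁, hv₁⟩ := laplace_mittagLeffler hα₀ hspos (hs ▸ hclam)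
    obtain ⟨hi₂, hv₂⟩ := hexp 0 (by simpa using hspos)
    obtain ⟨hi₃, hv₃⟩ := hexp s₀ (hs ▸ hcs)
    have hsplit : (fun t : ℝ => u t * Complex.exp (-(s * t))) = fun t : ℝ =>
        mittagLeffler α 1 (lam * ((t ^ α : ℝ) : ℂ)) * Complex.exp (-(s * t)) -
          Complex.exp ((0 - s) * t) -
          (α : ℂ)⁻¹ * (Complex.exp ((s₀ - s) * t) - Complex.exp ((0 - s) * t)) := by
      ext t
      have h1 : Complex.exp ((0 - s) * t) = Complex.exp (-(s * t)) := by congr 1; ring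
      have h2 : Complex.exp ((s₀ - s) * t) = Complex.exp (s₀ * t) * Complex.exp (-(s * t)) := by
        rw [← Complex.exp_add]; congr 1; ring
      rw [h1, h2]
      simp only [hu]
      ring
    rw [hsplit]
    refine ⟨(hi₁.sub hi₂).sub ((hi₃.sub hi₂).const_mul _), ?_⟩
    refine (integral_sub (hi₁.sub hi₂) ((hi₃.sub hi₂).const_mul _)).trans ?_
    simp only [Pi.sub_apply]
    rw [integral_sub hi₁ hi₂,
      integral_const_mul, integral_sub hi₃ hi₂, hv₁, hv₂, hv₃, hgs s hspos hne,
      Complex.cpow_neg]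
    have h1 : s - s₀ ≠ 0 := sub_ne_zero.2 hne
    have h2 : s ^ (α : ℂ) - lam ≠ 0 := sub_ne_zero.2 fun h => hne (huniq s hspos h)
    have h3 : s ^ (α : ℂ) ≠ 0 := by simp [Complex.cpow_eq_zero_iff, hs0]
    have h4 : 1 - lam * (s ^ (α : ℂ))⁻¹ = (s ^ (α : ℂ) - lam) / s ^ (α : ℂ) := by field_simp
    rw [h4, sub_zero]
    field_simp
    ring
  have hgc : Integrable fun y : ℝ => g (c + y * Complex.I) :=
    integrable_vertical hac le_rfl hr hgstrip.continuousOn hC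
  refine ⟨(2 * π)⁻¹ * ∫ y : ℝ, C * (1 + ‖y‖) ^ (-(1 + α)), fun t ht => ?_⟩
  have hcont : ContinuousAt u t := by
    have h1 : ContinuousAt (fun t : ℝ => lam * ((t ^ α : ℝ) : ℂ)) t :=
      continuousAt_const.mul (Complex.continuous_ofReal.continuousAt.comp
        (continuousAt_rpow_const t α (Or.inl ht.ne')))
    have h2 : ContinuousAt (fun t : ℝ => mittagLeffler α 1 (lam * ((t ^ α : ℝ) : ℂ))) t :=
      ContinuousAt.comp (f := fun t : ℝ => lam * ((t ^ α : ℝ) : ℂ))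
        (continuous_mittagLeffler hα₀).continuousAt h1
    exact (h2.sub continuousAt_const).sub (by fun_prop)
  have hinv := eq_integral_of_laplace_eq (hlap c (by simp)).1
    (fun y => (hlap (c + y * Complex.I) (by simp)).2) hgc ht hcont
  have hshift := integral_vertical_eq_of_differentiableOn (f := fun s => Complex.exp (s * t) * g s)
    (a := a) (b := c) (C := exp (c * t) * C) (r := 1 + α) hac hr
    (DifferentiableOn.mul (by fun_prop) hgstrip) fun s hsa hsc => by
      rw [norm_mul, Complex.norm_exp, Complex.re_mul_ofReal, mul_assoc]
      have := hC s hsa hsc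
      gcongr
  change ‖u t‖ ≤ _
  rw [hinv, ← hshift, norm_smul, Real.norm_of_nonneg (by positivity), mul_assoc]
  gcongr
  rw [← integral_mul_const]
  refine norm_integral_le_of_norm_le (((integrable_one_add_norm
    (by simpa using hα₀)).const_mul C).mul_const _) (ae_of_all _ fun y => ?_)
  have hre : (a + y * Complex.I).re = a := by simp
  have him : (a + y * Complex.I).im = y := by simp
  have hga := hC (a + y * Complex.I) hre.ge (hre.trans_le hac)
  rw [him] at hga
  rw [norm_mul, Complex.norm_exp, Complex.re_mul_ofReal, hre, mul_comm, Real.norm_eq_abs]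
  gcongr

/-- For `0 < α < 1` and nonzero `λ ∈ ℂ` with `|arg λ| < απ/2`,
`|E_α(λ t^α)| → ∞` as `t → ∞`. -/
theorem mittagLeffler_unstable_growth (α : ℝ) (hα₀ : 0 < α) (hα₁ : α < 1)
    (lam : ℂ) (hlam : lam ≠ 0) (harg : |Complex.arg lam| < α * π / 2) :
    Tendsto (fun t : ℝ => ‖mittagLeffler α 1 (lam * ((t ^ α : ℝ) : ℂ))‖) atTop atTop := by
  obtain ⟨s₀, hs₀, hpow, huniq⟩ := mittagLeffler_pole hα₀ hα₁ hlam harg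
  obtain ⟨D, hD⟩ := exists_mittagLeffler_asymptotic_bound hα₀ hα₁ hlam hs₀ hpow huniq
    (half_pos hs₀)
  have hexp : Tendsto (fun t : ℝ => exp (s₀.re / 2 * t)) atTop atTop :=
    tendsto_exp_atTop.comp (tendsto_id.const_mul_atTop (half_pos hs₀))
  have hlow : Tendsto (fun t : ℝ => exp (s₀.re / 2 * t) * (α⁻¹ * exp (s₀.re / 2 * t) - D) -
      ‖1 - (α : ℂ)⁻¹‖) atTop atTop :=
    tendsto_atTop_add_const_right _ _ (hexp.atTop_mul_atTop₀
      (tendsto_atTop_add_const_right _ _ (hexp.const_mul_atTop (inv_pos.2 hα₀))))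
  refine tendsto_atTop_mono' _ ?_ hlow
  filter_upwards [eventually_gt_atTop 0] with t ht
  set E := mittagLeffler α 1 (lam * ((t ^ α : ℝ) : ℂ))
  have hn : ‖(α : ℂ)⁻¹ * Complex.exp (s₀ * t)‖ =
      α⁻¹ * (exp (s₀.re / 2 * t) * exp (s₀.re / 2 * t)) := by
    rw [norm_mul, norm_inv, Complex.norm_real, Real.norm_of_nonneg hα₀.le, Complex.norm_exp,
      Complex.re_mul_ofReal, ← exp_add]
    ring_nf
  have htri : ‖(α : ℂ)⁻¹ * Complex.exp (s₀ * t)‖ ≤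
      ‖E‖ + ‖E - 1 - (α : ℂ)⁻¹ * (Complex.exp (s₀ * t) - 1)‖ + ‖1 - (α : ℂ)⁻¹‖ := by
    refine le_trans (le_of_eq ?_) ((norm_sub_le _ _).trans (add_le_add_left (norm_sub_le _ _) _))
    congr 1
    ring
  rw [hn] at htri
  have := hD t ht
  linarith
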